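/- arXiv:2001.04132 — 2 statements merged into one kernel-verified Lean document; each statement's English description precedes it below -/
import Mathlib

section
/- Let 1 ≤ s ≤ t ≤ r and a ≥ 1 be integers. For every (r,t)-graph H' there exists an (r+a, t+a)-graph H with τ_{s+a}(H) ≥ τ_s(H') + a. (Consequently, the maximum of τ_{s+a} over (r+a,t+a)-graphs is at least the maximum of τ_s over (r,t)-graphs plus a.) -/
/-- `E` is the edge set of an `r`-uniform `r`-partite hypergraph on vertex type `V`
with parts given by the fibres of `part`: each edge contains exactly one vertex
from each of the `r` parts. -/
def IsRPartite {V : Type} (r : ℕ) (part : V → Fin r) (E : Finset (Finset V)) : Prop :=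
  ∀ e ∈ E, ∀ j : Fin r, (e.filter (fun v => part v = j)).card = 1

/-- The hypergraph with edge set `E` is `t`-intersecting. -/
def IntersectingGe {V : Type} (t : ℕ) (E : Finset (Finset V)) : Prop :=
  ∀ e ∈ E, ∀ f ∈ E, t ≤ ((↑e ∩ ↑f : Set V)).ncard

/-- `C` is a vertex cover of the hypergraph with edge set `E`. -/
def IsCover {V : Type} (E : Finset (Finset V)) (C : Finset V) : Prop :=
  ∀ e ∈ E, ∃ v ∈ e, v ∈ C

/-- The cover number: the minimum size of a vertex cover. -/
noncomputable def coverNumber {V : Type} (E : Finset (Finset V)) : ℕ :=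
  sInf {n | ∃ C : Finset V, IsCover E C ∧ C.card = n}

/-- `B` is an `s`-cover of the hypergraph with edge set `E`: it meets every edge
in at least `s` vertices. -/
def IsSCover {V : Type} (s : ℕ) (E : Finset (Finset V)) (B : Finset V) : Prop :=
  ∀ e ∈ E, s ≤ ((↑e ∩ ↑B : Set V)).ncard

/-- The `s`-cover number: the minimum size of an `s`-cover. -/
noncomputable def sCoverNumber {V : Type} (s : ℕ) (E : Finset (Finset V)) : ℕ :=
  sInf {n | ∃ B : Finset V, IsSCover s E B ∧ B.card = n}

open Finset in
theorem IsRPartite.card_eq {V : Type} {r : ℕ} {part : V → Fin r} {E : Finset (Finset V)}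
    (h : IsRPartite r part E) {e : Finset V} (he : e ∈ E) : e.card = r := by
  rw [card_eq_sum_card_fiberwise (t := univ) (f := part) (fun _ _ => by simp),
    sum_congr rfl (fun j _ => h e he j)]
  simp

theorem sCoverNumber_le {V : Type} {s : ℕ} {E : Finset (Finset V)} {B : Finset V}
    (h : IsSCover s E B) : sCoverNumber s E ≤ B.card :=
  Nat.sInf_le ⟨B, h, rfl⟩

/-- In a finite uniform multipartite hypergraph, the `s`-cover number is attained whenever `s` is
at most the uniformity. -/
theorem IsRPartite.exists_isSCover_card_eq {V : Type} [Fintype V] {r s : ℕ} {part : V → Fin r}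
    {E : Finset (Finset V)} (h : IsRPartite r part E) (hs : s ≤ r) :
    ∃ B : Finset V, IsSCover s E B ∧ B.card = sCoverNumber s E :=
  Nat.sInf_mem (s := {n | ∃ B : Finset V, IsSCover s E B ∧ B.card = n})
    ⟨_, Finset.univ, fun e he => by simpa [h.card_eq he] using hs, rfl⟩

theorem IsSCover.add_card_le_card {V : Type} {s a : ℕ} {E : Finset (Finset V)} {B : Finset V}
    (hE : E.Nonempty) (h : IsSCover (s + a) E B) : sCoverNumber s E + a ≤ B.card := by
  classical
  have haB : a ≤ B.card := by
    obtain ⟨e, he⟩ := hE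
    have h1 := h e he
    rw [← Finset.coe_inter, Set.ncard_coe_finset] at h1
    have h2 := Finset.card_le_card (Finset.inter_subset_right (s₁ := e) (s₂ := B))
    omega
  obtain ⟨C, hCB, hC⟩ := Finset.exists_subset_card_eq (Nat.sub_le B.card a)
  have hcov : IsSCover s E C := fun e he => by
    have h1 := h e he
    rw [← Finset.coe_inter, Set.ncard_coe_finset] at h1 ⊢
    have h2 : e ∩ B ⊆ (e ∩ C) ∪ (B \ C) := by grind
    have h3 := (Finset.card_le_card h2).trans (Finset.card_union_le _ _)
    rw [Finset.card_sdiff_of_subset hCB] at h3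
    omega
  have := sCoverNumber_le hcov
  omega

/-- Add all of `A` as new vertices to every edge. -/
noncomputable def extendEdges {V : Type} (A : Type) [Fintype A] (E : Finset (Finset V)) :
    Finset (Finset (V ⊕ A)) :=
  open Classical in E.image (fun e => e.disjSum Finset.univ)

theorem mem_extendEdges {V A : Type} [Fintype A] {E : Finset (Finset V)}
    {e' : Finset (V ⊕ A)} :
    e' ∈ extendEdges A E ↔ ∃ e ∈ E, e.disjSum Finset.univ = e' := by
  simp [extendEdges]

theorem ncard_disjSum_univ_inter {V A : Type} [Fintype A] (e : Finset V) (B : Finset (V ⊕ A)) :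
    ((↑(e.disjSum (Finset.univ : Finset A)) ∩ ↑B : Set (V ⊕ A))).ncard =
      ((↑e ∩ ↑B.toLeft : Set V)).ncard + B.toRight.card := by
  classical
  rw [← Finset.coe_inter, ← Finset.coe_inter, Set.ncard_coe_finset, Set.ncard_coe_finset,
    ← Finset.card_disjSum]
  congr 1
  ext (x | x) <;> simp

theorem IsRPartite.extendEdges {V : Type} {r : ℕ} (a : ℕ) {part : V → Fin r}
    {E : Finset (Finset V)} (h : IsRPartite r part E) :
    IsRPartite (r + a) (Sum.elim (fun v => Fin.castAdd a (part v)) (Fin.natAdd r))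
      (extendEdges (Fin a) E) := by
  classical
  intro e' he' j
  obtain ⟨e, he, rfl⟩ := mem_extendEdges.1 he'
  induction j using Fin.addCases with
  | left j =>
    rw [← h e he j, ← Finset.card_map (Function.Embedding.inl : V ↪ V ⊕ Fin a)]
    congr 1
    ext (x | x) <;> simp [Fin.ext_iff]
    omega
  | right j =>
    rw [Finset.card_eq_one]
    refine ⟨Sum.inr j, ?_⟩
    ext (x | x) <;> simp [Fin.ext_iff]
    omega

theorem IntersectingGe.extendEdges {V : Type} {t : ℕ} (a : ℕ) {E : Finset (Finset V)}
    (h : IntersectingGe t E) : IntersectingGe (t + a) (extendEdges (Fin a) E) := by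
  intro e' he' f' hf'
  obtain ⟨e, he, rfl⟩ := mem_extendEdges.1 he'
  obtain ⟨f, hf, rfl⟩ := mem_extendEdges.1 hf'
  rw [ncard_disjSum_univ_inter]
  simpa using h e he f hf

theorem IsSCover.add_card_le_card_of_extendEdges {V : Type} {s a : ℕ} {E : Finset (Finset V)}
    {B : Finset (V ⊕ Fin a)} (hE : E.Nonempty) (h : IsSCover (s + a) (extendEdges (Fin a) E) B) :
    sCoverNumber s E + a ≤ B.card := by
  have hR : B.toRight.card ≤ a := by simpa using B.toRight.card_le_univ
  have hL : IsSCover (s + (a - B.toRight.card)) E B.toLeft := fun e he => by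
    have h1 := h _ (mem_extendEdges.2 ⟨e, he, rfl⟩)
    rw [ncard_disjSum_univ_inter] at h1
    omega
  have h1 := hL.add_card_le_card hE
  have h2 := B.card_toLeft_add_card_toRight
  omega

/-- **Lemma 3.8**: for `1 ≤ s ≤ t ≤ r` and `a ≥ 1`, for every `(r,t)`-graph `H'`
there is an `(r+a, t+a)`-graph `H` with `τ_{s+a}(H) ≥ τ_s(H') + a`. -/
theorem sCover_recursive_lower_bound (r t s a : ℕ)
    (hs : 1 ≤ s) (hst : s ≤ t) (htr : t ≤ r) (ha : 1 ≤ a)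
    {V : Type} [Fintype V] (part : V → Fin r) (E : Finset (Finset V))
    (hP : IsRPartite r part E) (hI : IntersectingGe t E) :
    ∃ (W : Type) (_ : Fintype W) (part' : W → Fin (r + a)) (E' : Finset (Finset W)),
      IsRPartite (r + a) part' E' ∧ IntersectingGe (t + a) E' ∧
      sCoverNumber s E + a ≤ sCoverNumber (s + a) E' := by
  rcases E.eq_empty_or_nonempty with rfl | hE
  · have hP' : IsRPartite (r + a) id {(Finset.univ : Finset (Fin (r + a)))} := by
      intro e he j
      obtain rfl := Finset.mem_singleton.1 he
      simp [Finset.filter_eq']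
    refine ⟨Fin (r + a), inferInstance, id, {Finset.univ}, hP', ?_, ?_⟩
    · intro e he f hf
      obtain rfl := Finset.mem_singleton.1 he
      obtain rfl := Finset.mem_singleton.1 hf
      simpa using htr
    · obtain ⟨B, hB, hcard⟩ := hP'.exists_isSCover_card_eq
        (show s + a ≤ r + a by omega)
      have h0 : sCoverNumber s (∅ : Finset (Finset V)) ≤ (∅ : Finset V).card :=
        sCoverNumber_le (by simp [IsSCover])
      have h1 := hB _ (Finset.mem_singleton_self _)
      simp only [Finset.coe_univ, Set.univ_inter, Set.ncard_coe_finset] at h1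
      rw [Finset.card_empty] at h0
      omega
  · refine ⟨V ⊕ Fin a, inferInstance, _, _, hP.extendEdges a, hI.extendEdges a, ?_⟩
    obtain ⟨B, hB, hcard⟩ := (hP.extendEdges a).exists_isSCover_card_eq
      (show s + a ≤ r + a by omega)
    rw [← hcard]
    exact hB.add_card_le_card_of_extendEdges hE
end

section
/- Let 1 ≤ s ≤ t ≤ r be integers with r ≤ 3t − 2s. Then every (r,t)-graph H satisfies τ_s(H) ≤ ⌊(r−t)/2⌋ + s. -/
theorem IsRPartite.part_injOn {V : Type} {r : ℕ} {part : V → Fin r} {E : Finset (Finset V)}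
    (hP : IsRPartite r part E) {e : Finset V} (he : e ∈ E) : Set.InjOn part e := by
  intro v hv w hw h
  exact Finset.card_le_one.1 (hP e he (part w)).le v (by simpa [h] using hv) w (by simpa using hw)

/-- For three edges `e`, `f`, `g`, the vertices of `g` in exactly one of `e` and `f` lie in parts
not met by `e ∩ f`. -/
theorem IsRPartite.card_inter_add_card_inter_le {V : Type} [DecidableEq V] {r : ℕ}
    {part : V → Fin r} {E : Finset (Finset V)} (hP : IsRPartite r part E) {e f g : Finset V}
    (he : e ∈ E) (hf : f ∈ E) (hg : g ∈ E) :
    (g ∩ e).card + (g ∩ f).card + (e ∩ f).card ≤ r + 2 * (g ∩ (e ∩ f)).card := by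
  have hdisj : Disjoint (((g ∩ (e ∪ f)) \ (e ∩ f)).image part) ((e ∩ f).image part) := by
    rw [Finset.disjoint_left]
    intro j hj hj'
    obtain ⟨v, hv, rfl⟩ := Finset.mem_image.1 hj
    obtain ⟨w, hw, hwv⟩ := Finset.mem_image.1 hj'
    simp only [Finset.mem_sdiff, Finset.mem_inter, Finset.mem_union] at hv hw
    rcases hv.1.2 with hve | hvf
    · have := hP.part_injOn he hw.1 hve hwv
      subst this
      exact hv.2 hw
    · have := hP.part_injOn hf hw.2 hvf hwv
      subst this
      exact hv.2 hw
  have hle := Finset.card_le_univ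
    (((g ∩ (e ∪ f)) \ (e ∩ f)).image part ∪ (e ∩ f).image part)
  rw [Finset.card_union_of_disjoint hdisj, Fintype.card_fin,
    Finset.card_image_of_injOn ((hP.part_injOn hg).mono fun v hv => by
      simp only [Finset.coe_sdiff, Finset.coe_inter] at hv
      exact hv.1.1),
    Finset.card_image_of_injOn ((hP.part_injOn he).mono fun v hv => by
      simp only [Finset.coe_inter] at hv
      exact hv.1)] at hle
  have hsplit := Finset.card_sdiff_add_card_inter (g ∩ (e ∪ f)) (e ∩ f)
  have hinter : g ∩ (e ∪ f) ∩ (e ∩ f) = g ∩ (e ∩ f) := by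
    ext v
    simp only [Finset.mem_inter, Finset.mem_union]
    tauto
  have hunion := Finset.card_union_add_card_inter (g ∩ e) (g ∩ f)
  rw [← Finset.inter_union_distrib_left, ← Finset.inter_inter_distrib_left] at hunion
  rw [hinter] at hsplit
  omega

theorem sCoverNumber_le_card {V : Type} {s : ℕ} {E : Finset (Finset V)} {B : Finset V}
    (hB : IsSCover s E B) : sCoverNumber s E ≤ B.card :=
  Nat.sInf_le ⟨B, hB, rfl⟩

/-- **Proposition 3.9** (upper bound): for `1 ≤ s ≤ t ≤ r` with `r ≤ 3t - 2s`,
every `(r,t)`-graph `H` satisfies `τ_s(H) ≤ ⌊(r - t)/2⌋ + s`. -/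
theorem sCover_upper_bound {V : Type} [Fintype V] (r t s : ℕ)
    (hs : 1 ≤ s) (hst : s ≤ t) (htr : t ≤ r) (hr : r ≤ 3 * t - 2 * s)
    (part : V → Fin r) (E : Finset (Finset V))
    (hP : IsRPartite r part E) (hI : IntersectingGe t E) :
    sCoverNumber s E ≤ (r - t) / 2 + s := by
  classical
  rcases E.eq_empty_or_nonempty with rfl | hE
  · exact (sCoverNumber_le_card (B := ∅) (by simp [IsSCover])).trans (by simp)
  obtain ⟨⟨e, f⟩, hef, hmin⟩ :=
    (E ×ˢ E).exists_min_image (fun p => (p.1 ∩ p.2).card) (hE.product hE)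
  simp only [Finset.mem_product] at hef
  obtain ⟨he, hf⟩ := hef
  have ht := hI e he f hf
  rw [← Finset.coe_inter, Set.ncard_coe_finset] at ht
  obtain ⟨B, hBsub, hBcard⟩ :=
    Finset.exists_subset_card_eq (s := e ∩ f) (n := (r - t) / 2 + s) (by omega)
  rw [← hBcard]
  refine sCoverNumber_le_card fun g hg => ?_
  rw [← Finset.coe_inter, Set.ncard_coe_finset]
  have hge : (e ∩ f).card ≤ (g ∩ e).card := hmin (g, e) (Finset.mk_mem_product hg he)
  have hgf : (e ∩ f).card ≤ (g ∩ f).card := hmin (g, f) (Finset.mk_mem_product hg hf)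
  have hthree := hP.card_inter_add_card_inter_le he hf hg
  have hunion : (g ∩ (e ∩ f) ∪ B).card ≤ (e ∩ f).card :=
    Finset.card_le_card (Finset.union_subset Finset.inter_subset_right hBsub)
  have hcard := Finset.card_union_add_card_inter (g ∩ (e ∩ f)) B
  rw [Finset.inter_assoc, Finset.inter_eq_right.2 hBsub] at hcard
  omega
end
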